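/- arXiv:1809.06365 — 7 statements merged into one kernel-verified Lean document; each statement's English description precedes it below -/
import Mathlib

section
/- Let m₀ be a positive integer and let J, Z be real m₀ × m₀ matrices such that J + Jᵀ is positive definite and Z + Zᵀ is positive semidefinite. Then the matrix I + J·Z is invertible. -/
open Matrix

/-- The quadratic form of `M + Mᵀ` is twice that of `M`. -/
theorem dotProduct_add_transpose_mulVec_self {n R : Type*} [Fintype n] [CommRing R]
    (M : Matrix n n R) (v : n → R) :
    v ⬝ᵥ ((M + Mᵀ) *ᵥ v) = 2 * (v ⬝ᵥ (M *ᵥ v)) := by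
  rw [add_mulVec, dotProduct_add, mulVec_transpose, dotProduct_comm v (v ᵥ* M),
    ← dotProduct_mulVec, two_mul]

/-- If `J + Jᵀ` is positive definite and `Z + Zᵀ` is positive
semidefinite, then `I + J * Z` is invertible. -/
theorem one_add_mul_isUnit_of_sym_posDef_posSemidef
    (m₀ : ℕ) (hm : 0 < m₀) (J Z : Matrix (Fin m₀) (Fin m₀) ℝ)
    (hJ : (J + Jᵀ).PosDef) (hZ : (Z + Zᵀ).PosSemidef) :
    IsUnit (1 + J * Z) := by
  rw [isUnit_iff_isUnit_det, isUnit_iff_ne_zero]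
  intro hdet
  obtain ⟨v, hv, hker⟩ := exists_mulVec_eq_zero_iff.mpr hdet
  rw [add_mulVec, one_mulVec, ← mulVec_mulVec] at hker
  have hw : Z *ᵥ v ≠ 0 := fun h => hv (by simpa [h] using hker)
  have hpos := hJ.dotProduct_mulVec_pos hw
  have hnonneg := hZ.dotProduct_mulVec_nonneg v
  rw [star_trivial, dotProduct_add_transpose_mulVec_self] at hpos hnonneg
  have hsum : (Z *ᵥ v) ⬝ᵥ v + (Z *ᵥ v) ⬝ᵥ (J *ᵥ (Z *ᵥ v)) = 0 := by
    rw [← dotProduct_add, hker, dotProduct_zero]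
  rw [dotProduct_comm v] at hnonneg
  linarith
end

section
/- Let m₀ be a positive integer and let J, Z be real m₀ × m₀ matrices such that Sym(J) is positive definite and Sym(Z) is positive semidefinite. Define Δ = Z·(I + J·Z)⁻¹ (the inverse exists). Then (i) the matrix I − Δ·J is invertible, and (ii) the matrix Sym(Δ) − Δ·Sym(J)·Δᵀ is positive semidefinite. -/
open Matrix

/-- A real matrix and its symmetrization define the same quadratic form up to a factor `2`. -/
lemma dotProduct_add_transpose_mulVec {n : Type*} [Fintype n] (M : Matrix n n ℝ) (v : n → ℝ) :
    v ⬝ᵥ ((M + Mᵀ) *ᵥ v) = 2 * (v ⬝ᵥ (M *ᵥ v)) := by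
  rw [add_mulVec, dotProduct_add, mulVec_transpose, dotProduct_comm v (v ᵥ* M),
    ← dotProduct_mulVec, two_mul]

/-- If `Sym(J)` is positive definite and `Sym(Z)` is positive semidefinite, then `1 + J * Z` is
invertible. -/
lemma isUnit_det_one_add_mul {n : Type*} [Fintype n] [DecidableEq n] {J Z : Matrix n n ℝ}
    (hJ : (J + Jᵀ).PosDef) (hZ : (Z + Zᵀ).PosSemidef) : IsUnit (1 + J * Z).det := by
  rw [isUnit_iff_ne_zero]
  intro hdet
  obtain ⟨v, hv, h⟩ := exists_mulVec_eq_zero_iff.mpr hdet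
  rw [add_mulVec, one_mulVec, ← mulVec_mulVec] at h
  have hvJ : v = -(J *ᵥ (Z *ᵥ v)) := eq_neg_of_add_eq_zero_left h
  have hw : Z *ᵥ v ≠ 0 := fun hw => hv (by rw [hvJ, hw, mulVec_zero, neg_zero])
  have hpos := hJ.dotProduct_mulVec_pos hw
  have hnonneg := hZ.dotProduct_mulVec_nonneg v
  rw [star_trivial, dotProduct_add_transpose_mulVec] at hpos hnonneg
  have heq : (Z *ᵥ v) ⬝ᵥ v = -((Z *ᵥ v) ⬝ᵥ (J *ᵥ (Z *ᵥ v))) := by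
    rw [← dotProduct_neg, ← hvJ]
  rw [dotProduct_comm] at heq
  linarith

/-- With `Sym(J)` positive definite and `Sym(Z)` positive
semidefinite, set `Δ = Z * (1 + J * Z)⁻¹`.  Then `1 - Δ * J` is invertible and
`Sym(Δ) - Δ * Sym(J) * Δᵀ` is positive semidefinite. -/
theorem delta_props_of_Z
    (m₀ : ℕ) (hm : 0 < m₀) (J Z : Matrix (Fin m₀) (Fin m₀) ℝ)
    (hJ : (J + Jᵀ).PosDef) (hZ : (Z + Zᵀ).PosSemidef)
    (Δ : Matrix (Fin m₀) (Fin m₀) ℝ) (hΔ : Δ = Z * (1 + J * Z)⁻¹) :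
    IsUnit (1 - Δ * J) ∧ ((Δ + Δᵀ) - Δ * (J + Jᵀ) * Δᵀ).PosSemidef := by
  have hdet := isUnit_det_one_add_mul hJ hZ
  have hΔZ : Δ * (1 + J * Z) = Z := by
    rw [hΔ, Matrix.mul_assoc, nonsing_inv_mul _ hdet, Matrix.mul_one]
  have hAZ : (1 - Δ * J) * Z = Δ := by
    calc (1 - Δ * J) * Z = Z - Δ * (1 + J * Z) + Δ := by noncomm_ring
      _ = Δ := by rw [hΔZ, sub_self, zero_add]
  constructor
  · refine IsUnit.of_mul_eq_one (1 + Z * J) ?_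
    calc (1 - Δ * J) * (1 + Z * J) = 1 - Δ * J + (1 - Δ * J) * Z * J := by noncomm_ring
      _ = 1 := by rw [hAZ, sub_add_cancel]
  · have hAZt : Zᵀ * (1 - Δ * J)ᵀ = Δᵀ := by rw [← transpose_mul, hAZ]
    have hcongr : (Δ + Δᵀ) - Δ * (J + Jᵀ) * Δᵀ =
        (1 - Δ * J) * (Z + Zᵀ) * (1 - Δ * J)ᴴ := by
      rw [conjTranspose_eq_transpose_of_trivial, Matrix.mul_add _ Z, Matrix.add_mul, hAZ,
        Matrix.mul_assoc _ Zᵀ, hAZt, transpose_sub, transpose_one, transpose_mul]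
      noncomm_ring
    rw [hcongr]
    exact hZ.mul_mul_conjTranspose_same _
end

section
/- Let m₀ be a positive integer, let J be a real m₀ × m₀ matrix with Sym(J) positive definite, and let Δ be a real m₀ × m₀ matrix such that I − Δ·J is invertible and Sym(Δ) − Δ·Sym(J)·Δᵀ is positive semidefinite. Then there exists a real m₀ × m₀ matrix Z with Sym(Z) positive semidefinite such that I + J·Z is invertible and Δ = Z·(I + J·Z)⁻¹; explicitly, Z = (I − Δ·J)⁻¹·Δ has these properties. -/
open Matrix

section

variable {n R : Type*} [Fintype n] [DecidableEq n] [CommRing R]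

/-- The push-through identity, which exhibits `1 - J * Δ` as a right inverse. -/
theorem one_add_mul_inv_mul_one_sub {J Δ : Matrix n n R} (h : IsUnit (1 - Δ * J)) :
    (1 + J * ((1 - Δ * J)⁻¹ * Δ)) * (1 - J * Δ) = 1 := by
  have hA : (1 - Δ * J)⁻¹ * (1 - Δ * J) = 1 :=
    nonsing_inv_mul _ ((isUnit_iff_isUnit_det _).mp h)
  calc (1 + J * ((1 - Δ * J)⁻¹ * Δ)) * (1 - J * Δ)
      = 1 - J * Δ + J * ((1 - Δ * J)⁻¹ * (1 - Δ * J)) * Δ := by noncomm_ring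
    _ = 1 := by rw [hA]; noncomm_ring

theorem inv_one_sub_mul_mul_one_sub {J Δ : Matrix n n R} (h : IsUnit (1 - Δ * J)) :
    (1 - Δ * J)⁻¹ * Δ * (1 - J * Δ) = Δ := by
  have hA : (1 - Δ * J)⁻¹ * (1 - Δ * J) = 1 :=
    nonsing_inv_mul _ ((isUnit_iff_isUnit_det _).mp h)
  calc (1 - Δ * J)⁻¹ * Δ * (1 - J * Δ)
      = (1 - Δ * J)⁻¹ * (1 - Δ * J) * Δ := by noncomm_ring
    _ = Δ := by rw [hA, one_mul]

/-- The symmetric part of `(1 - Δ * J)⁻¹ * Δ` is congruent to `Sym(Δ) - Δ * Sym(J) * Δᵀ`. -/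
theorem inv_one_sub_mul_add_transpose {J Δ : Matrix n n R} (h : IsUnit (1 - Δ * J)) :
    (1 - Δ * J)⁻¹ * Δ + ((1 - Δ * J)⁻¹ * Δ)ᵀ =
      (1 - Δ * J)⁻¹ * ((Δ + Δᵀ) - Δ * (J + Jᵀ) * Δᵀ) * ((1 - Δ * J)⁻¹)ᵀ := by
  have hA : (1 - Δ * J)⁻¹ * (1 - Δ * J) = 1 :=
    nonsing_inv_mul _ ((isUnit_iff_isUnit_det _).mp h)
  have hAt : (1 - Δ * J)ᵀ * ((1 - Δ * J)⁻¹)ᵀ = 1 := by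
    rw [← transpose_mul, hA, transpose_one]
  have key : (Δ + Δᵀ) - Δ * (J + Jᵀ) * Δᵀ = Δ * (1 - Δ * J)ᵀ + (1 - Δ * J) * Δᵀ := by
    rw [transpose_sub, transpose_mul, transpose_one]
    noncomm_ring
  rw [key, mul_add, add_mul, ← mul_assoc, ← mul_assoc, hA, one_mul,
    mul_assoc _ _ ((1 - Δ * J)⁻¹)ᵀ, hAt, mul_one, transpose_mul]

end

/-- If `Sym(J)` is positive definite, `1 - Δ * J` is invertible
and `Sym(Δ) - Δ * Sym(J) * Δᵀ` is positive semidefinite, then there is a matrix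
`Z` with `Sym(Z)` positive semidefinite, `1 + J * Z` invertible and
`Δ = Z * (1 + J * Z)⁻¹`; explicitly, `Z = (1 - Δ * J)⁻¹ * Δ` works. -/
theorem exists_Z_of_delta
    (m₀ : ℕ) (hm : 0 < m₀) (J Δ : Matrix (Fin m₀) (Fin m₀) ℝ)
    (hJ : (J + Jᵀ).PosDef)
    (hinv : IsUnit (1 - Δ * J))
    (hΔ : ((Δ + Δᵀ) - Δ * (J + Jᵀ) * Δᵀ).PosSemidef) :
    (∃ Z : Matrix (Fin m₀) (Fin m₀) ℝ,
        (Z + Zᵀ).PosSemidef ∧ IsUnit (1 + J * Z) ∧ Δ = Z * (1 + J * Z)⁻¹) ∧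
      (((1 - Δ * J)⁻¹ * Δ + ((1 - Δ * J)⁻¹ * Δ)ᵀ).PosSemidef ∧
        IsUnit (1 + J * ((1 - Δ * J)⁻¹ * Δ)) ∧
        Δ = (1 - Δ * J)⁻¹ * Δ * (1 + J * ((1 - Δ * J)⁻¹ * Δ))⁻¹) := by
  have hprod := one_add_mul_inv_mul_one_sub hinv
  have hmain : ((1 - Δ * J)⁻¹ * Δ + ((1 - Δ * J)⁻¹ * Δ)ᵀ).PosSemidef ∧
      IsUnit (1 + J * ((1 - Δ * J)⁻¹ * Δ)) ∧
      Δ = (1 - Δ * J)⁻¹ * Δ * (1 + J * ((1 - Δ * J)⁻¹ * Δ))⁻¹ := by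
    refine ⟨?_, IsUnit.of_mul_eq_one _ hprod, ?_⟩
    · rw [inv_one_sub_mul_add_transpose hinv, ← conjTranspose_eq_transpose_of_trivial (_⁻¹)]
      exact hΔ.mul_mul_conjTranspose_same _
    · rw [inv_eq_right_inv hprod, inv_one_sub_mul_mul_one_sub hinv]
  exact ⟨⟨_, hmain⟩, hmain⟩
end

section
/- Let m₀ and N be positive integers, let w be a real m₀ × m₀ symmetric positive definite matrix, and let Δ be a real m₀ × m₀ matrix such that Sym(Δ) − Δ·w·Δᵀ is positive semidefinite. Then for any real N × m₀ matrix M and any real m₀ × N matrix G, the matrix Sym(M·w⁻¹·G) + Gᵀ·w⁻¹·G + M·w⁻¹·Mᵀ − Sym(M·Δ·G) is positive semidefinite. -/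
open Matrix

/-- For a symmetric positive definite `w` and `Δ` with
`Sym(Δ) - Δ·w·Δᵀ` positive semidefinite, the matrix
`Sym(M·w⁻¹·G) + Gᵀ·w⁻¹·G + M·w⁻¹·Mᵀ - Sym(M·Δ·G)` is positive semidefinite. -/
theorem completion_bound
    (m₀ N : ℕ) (hm : 0 < m₀) (hN : 0 < N)
    (w : Matrix (Fin m₀) (Fin m₀) ℝ) (hw : w.PosDef)
    (Δ : Matrix (Fin m₀) (Fin m₀) ℝ)
    (hΔ : ((Δ + Δᵀ) - Δ * w * Δᵀ).PosSemidef)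
    (M : Matrix (Fin N) (Fin m₀) ℝ) (G : Matrix (Fin m₀) (Fin N) ℝ) :
    ((M * w⁻¹ * G + (M * w⁻¹ * G)ᵀ) + Gᵀ * w⁻¹ * G + M * w⁻¹ * Mᵀ
      - (M * Δ * G + (M * Δ * G)ᵀ)).PosSemidef := by
  have hwT : wᵀ = w := by simpa using hw.isHermitian.eq
  have hwiT : w⁻¹ᵀ = w⁻¹ := by rw [transpose_nonsing_inv, hwT]
  have hdet : IsUnit w.det := (isUnit_iff_isUnit_det w).1 hw.isUnit
  have hl : ∀ X : Matrix (Fin m₀) (Fin N) ℝ, w * (w⁻¹ * X) = X := fun X =>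
    mul_nonsing_inv_cancel_left w X hdet
  have hr : ∀ X : Matrix (Fin m₀) (Fin N) ℝ, w⁻¹ * (w * X) = X := fun X =>
    nonsing_inv_mul_cancel_left w X hdet
  have hsq : (M * w⁻¹ * G + (M * w⁻¹ * G)ᵀ) + Gᵀ * w⁻¹ * G + M * w⁻¹ * Mᵀ
      - (M * Δ * G + (M * Δ * G)ᵀ) =
      (Mᵀ - w * Δᵀ * Mᵀ + G)ᴴ * w⁻¹ * (Mᵀ - w * Δᵀ * Mᵀ + G)
        + M * ((Δ + Δᵀ) - Δ * w * Δᵀ) * Mᴴ := by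
    simp only [conjTranspose_eq_transpose_of_trivial, transpose_add, transpose_sub, transpose_mul,
      transpose_transpose, hwT, hwiT, Matrix.add_mul, Matrix.sub_mul, Matrix.mul_add,
      Matrix.mul_sub, Matrix.mul_assoc, hl, hr]
    abel
  rw [hsq]
  exact (hw.inv.posSemidef.conjTranspose_mul_mul_same (Mᵀ - w * Δᵀ * Mᵀ + G)).add
    (hΔ.mul_mul_conjTranspose_same M)
end

section
/- Let m₀ and N be positive integers, let w be a real m₀ × m₀ symmetric positive definite matrix, let μ > 0, and let Δ be a real m₀ × m₀ matrix such that Sym(Δ) − Δ·w·Δᵀ is positive semidefinite. Then for any real N × m₀ matrix M and any real m₀ × N matrix G, the matrix Sym(M·w⁻¹·G) + Gᵀ·w⁻¹·G + M·(w⁻¹ + μ⁻¹·I)·Mᵀ − Sym(M·Δ·G) is positive semidefinite. -/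
open Matrix

/-- Completing the square: if `v` is a symmetric inverse of `w`, the matrix splits into three
congruence terms. -/
theorem completion_identity {m n R : Type*} [Fintype m] [DecidableEq m] [CommRing R]
    {w v : Matrix m m R} (hwv : w * v = 1) (hw : wᵀ = w) (hv : vᵀ = v) (c : R)
    (Δ : Matrix m m R) (M : Matrix n m R) (G : Matrix m n R) :
    (M * v * G + (M * v * G)ᵀ) + Gᵀ * v * G + M * (v + c • (1 : Matrix m m R)) * Mᵀ
      - (M * Δ * G + (M * Δ * G)ᵀ) =
    (Gᵀ + M - M * Δ * w) * v * (Gᵀ + M - M * Δ * w)ᵀ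
      + M * ((Δ + Δᵀ) - Δ * w * Δᵀ) * Mᵀ + c • (M * Mᵀ) := by
  have hvw : v * w = 1 := mul_eq_one_comm.mp hwv
  have hwv' (X : Matrix m n R) : w * (v * X) = X := by
    rw [← Matrix.mul_assoc, hwv, Matrix.one_mul]
  have hvw' (X : Matrix m n R) : v * (w * X) = X := by
    rw [← Matrix.mul_assoc, hvw, Matrix.one_mul]
  simp only [transpose_add, transpose_sub, transpose_mul, transpose_transpose, hw, hv,
    Matrix.add_mul, Matrix.sub_mul, Matrix.mul_add, Matrix.mul_sub, Matrix.mul_assoc,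
    hwv', hvw', Matrix.mul_smul, Matrix.smul_mul, Matrix.one_mul]
  abel

/-- For a symmetric positive definite `w`, `μ > 0` and `Δ` with
`Sym(Δ) - Δ·w·Δᵀ` positive semidefinite, the matrix
`Sym(M·w⁻¹·G) + Gᵀ·w⁻¹·G + M·(w⁻¹ + μ⁻¹·I)·Mᵀ - Sym(M·Δ·G)` is positive
semidefinite. -/
theorem completion_bound_mu
    (m₀ N : ℕ) (hm : 0 < m₀) (hN : 0 < N)
    (w : Matrix (Fin m₀) (Fin m₀) ℝ) (hw : w.PosDef)
    (μ : ℝ) (hμ : 0 < μ)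
    (Δ : Matrix (Fin m₀) (Fin m₀) ℝ)
    (hΔ : ((Δ + Δᵀ) - Δ * w * Δᵀ).PosSemidef)
    (M : Matrix (Fin N) (Fin m₀) ℝ) (G : Matrix (Fin m₀) (Fin N) ℝ) :
    ((M * w⁻¹ * G + (M * w⁻¹ * G)ᵀ) + Gᵀ * w⁻¹ * G
      + M * (w⁻¹ + μ⁻¹ • (1 : Matrix (Fin m₀) (Fin m₀) ℝ)) * Mᵀ
      - (M * Δ * G + (M * Δ * G)ᵀ)).PosSemidef := by
  have hwT : wᵀ = w := by simpa using hw.isHermitian.eq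
  have hvT : w⁻¹ᵀ = w⁻¹ := by rw [transpose_nonsing_inv, hwT]
  have hwv : w * w⁻¹ = 1 := mul_nonsing_inv _ ((isUnit_iff_isUnit_det w).mp hw.isUnit)
  rw [completion_identity hwv hwT hvT]
  simp only [← conjTranspose_eq_transpose_of_trivial] at hΔ ⊢
  exact ((hw.inv.posSemidef.mul_mul_conjTranspose_same _).add
    (hΔ.mul_mul_conjTranspose_same M)).add
    ((posSemidef_self_mul_conjTranspose M).smul (inv_nonneg.mpr hμ.le))
end

section
/- (Lyapunov negativity in Theorem 1.) Let s and n be positive integers with n ≤ s, let S be a real symmetric s × s matrix, P a real s × s matrix, E the s × n matrix whose top n × n block is the identity and bottom block zero, and let τ > 0, ξ ≥ 0. Suppose the (s+n) × (s+n) block matrix [[S + τ·ξ²·I, P·E], [Eᵀ·P, −τ·I]] is negative definite. Then for every nonzero X ∈ ℝˢ and every z ∈ ℝⁿ with ‖z‖ ≤ ξ·‖X‖, one has Xᵀ·S·X + 2·Xᵀ·P·E·z < 0. -/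
open Matrix

/-- **Lyapunov negativity in Theorem 1.** If the block matrix
`[[S + τξ²I, PE], [EᵀP, −τI]]` is negative definite, then for every nonzero `X`
and every `z` with `‖z‖ ≤ ξ‖X‖` one has `XᵀSX + 2XᵀPEz < 0`. -/
theorem lyapunov_negativity
    (s n : ℕ) (hs : 0 < s) (hn : 0 < n) (hns : n ≤ s)
    (S : Matrix (Fin s) (Fin s) ℝ) (hS : S.IsHermitian)
    (P : Matrix (Fin s) (Fin s) ℝ)
    (E : Matrix (Fin s) (Fin n) ℝ)
    (hE : E = Matrix.of fun (i : Fin s) (j : Fin n) => if (i : ℕ) = (j : ℕ) then (1 : ℝ) else 0)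
    (τ ξ : ℝ) (hτ : 0 < τ) (hξ : 0 ≤ ξ)
    (hLMI : (-(Matrix.fromBlocks
        (S + (τ * ξ ^ 2) • (1 : Matrix (Fin s) (Fin s) ℝ)) (P * E)
        (Eᵀ * P) (-(τ • (1 : Matrix (Fin n) (Fin n) ℝ))))).PosDef) :
    ∀ X : EuclideanSpace ℝ (Fin s), X ≠ 0 →
      ∀ z : EuclideanSpace ℝ (Fin n), ‖z‖ ≤ ξ * ‖X‖ →
        X ⬝ᵥ S.mulVec X + 2 * (X ⬝ᵥ (P * E).mulVec z) < 0 := by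
  intro X hX z hz
  have hherm : (P * E)ᵀ = Eᵀ * P := by
    have h := hLMI.isHermitian.neg
    rw [neg_neg, isHermitian_fromBlocks_iff] at h
    simpa only [conjTranspose_eq_transpose_of_trivial] using h.2.1
  have hpos := hLMI.dotProduct_mulVec_pos (x := Sum.elim X.ofLp z.ofLp) (by
    intro h
    apply hX
    ext i
    exact congrFun h (Sum.inl i))
  have hcross : z.ofLp ⬝ᵥ (Eᵀ * P) *ᵥ X.ofLp = X.ofLp ⬝ᵥ (P * E) *ᵥ z.ofLp := by
    rw [← hherm, mulVec_transpose, dotProduct_comm, dotProduct_mulVec]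
  have hsq : z.ofLp ⬝ᵥ z.ofLp ≤ ξ ^ 2 * (X.ofLp ⬝ᵥ X.ofLp) := by
    have h := pow_le_pow_left₀ (norm_nonneg z) hz 2
    rw [mul_pow, EuclideanSpace.real_norm_sq_eq, EuclideanSpace.real_norm_sq_eq] at h
    simpa only [dotProduct, ← sq] using h
  rw [star_trivial, neg_mulVec, dotProduct_neg, fromBlocks_mulVec, sumElim_dotProduct_sumElim]
    at hpos
  simp only [Sum.elim_comp_inl, Sum.elim_comp_inr, add_mulVec, neg_mulVec, smul_mulVec,
    one_mulVec, dotProduct_add, dotProduct_neg, dotProduct_smul, smul_eq_mul, hcross] at hpos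
  linarith [mul_le_mul_of_nonneg_left hsq hτ.le]
end

section
/- (Lemma 3, LMI characterization of the fractional stability region.) Let A be a real n × n matrix, let 0 < q < 1, set θ = (1 − q)·π/2 and r = e^{iθ} ∈ ℂ. Then every eigenvalue λ ∈ ℂ of A satisfies |arg(λ)| > q·π/2 if and only if there exists a complex Hermitian positive definite n × n matrix X such that the real symmetric matrix (r·X + r̄·X̄)ᵀ·Aᵀ + A·(r·X + r̄·X̄) is negative definite, where X̄ denotes the entrywise complex conjugate of X. -/
open Matrix ComplexOrder

/-- A block matrix with positive definite upper left block and Schur complement is positive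
definite. -/
theorem Matrix.PosDef.fromBlocks_of_schur {ι κ : Type*} [Fintype ι] [DecidableEq ι] [Fintype κ]
    [DecidableEq κ] {A : Matrix ι ι ℂ} {B : Matrix ι κ ℂ} {D : Matrix κ κ ℂ} (hA : A.PosDef)
    (hD : (D - Bᴴ * A⁻¹ * B).PosDef) : (fromBlocks A B Bᴴ D).PosDef := by
  have := hA.isUnit.invertible
  rw [PosSemidef.posDef_iff_det_ne_zero ((PosDef.fromBlocks₁₁ B D hA).2 hD.posSemidef),
    det_fromBlocks₁₁, invOf_eq_nonsing_inv]
  exact mul_ne_zero hA.det_pos.ne' hD.det_pos.ne'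

/-- The Lyapunov-type condition that `-(A Z + Zᴴ Aᴴ)` is positive definite for some
`Z = r X₁ + s X₂` with `X₁` and `X₂` positive definite. -/
def IsConeStable {ι : Type*} [Fintype ι] (r s : ℂ) (A : Matrix ι ι ℂ) : Prop :=
  ∃ X₁ X₂ : Matrix ι ι ℂ, X₁.PosDef ∧ X₂.PosDef ∧
    (-(A * (r • X₁ + s • X₂) + (r • X₁ + s • X₂)ᴴ * Aᴴ)).PosDef

theorem IsConeStable.of_intertwining {ι κ : Type*} [Fintype ι] [Fintype κ] {r s : ℂ}
    {A : Matrix ι ι ℂ} {B : Matrix κ κ ℂ} (hB : IsConeStable r s B) (T : Matrix ι κ ℂ)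
    (hT : Function.Injective T.vecMul) (h : A * T = T * B) : IsConeStable r s A := by
  obtain ⟨X₁, X₂, h₁, h₂, hN⟩ := hB
  refine ⟨T * X₁ * Tᴴ, T * X₂ * Tᴴ, h₁.mul_mul_conjTranspose_same hT,
    h₂.mul_mul_conjTranspose_same hT, ?_⟩
  convert! hN.mul_mul_conjTranspose_same hT using 1
  have hZ : r • (T * X₁ * Tᴴ) + s • (T * X₂ * Tᴴ) = T * (r • X₁ + s • X₂) * Tᴴ := by
    simp [Matrix.mul_add, Matrix.add_mul]
  rw [hZ]
  generalize r • X₁ + s • X₂ = Z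
  have h1 : A * (T * Z * Tᴴ) = T * (B * Z) * Tᴴ := by
    simp only [← Matrix.mul_assoc, h]
  have h2 : (T * Z * Tᴴ)ᴴ * Aᴴ = T * (Zᴴ * Bᴴ) * Tᴴ := by
    rw [← conjTranspose_mul, h1]
    simp only [conjTranspose_mul, conjTranspose_conjTranspose, Matrix.mul_assoc]
  rw [h1, h2, Matrix.mul_neg, Matrix.neg_mul, Matrix.mul_add, Matrix.add_mul]

theorem posDef_unit {M : Matrix Unit Unit ℂ} (h : 0 < M () ()) : M.PosDef := by
  have : M = diagonal fun _ => M () () := by ext ⟨⟩ ⟨⟩; simp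
  rw [this]
  exact PosDef.diagonal fun _ => h

theorem IsConeStable.fromBlocks {ι : Type*} [Fintype ι] [DecidableEq ι] {r s : ℂ}
    {A : Matrix ι ι ℂ} (hA : IsConeStable r s A) (C : Matrix Unit ι ℂ) (D : Matrix Unit Unit ℂ)
    {a b : ℝ} (ha : 0 < a) (hb : 0 < b) (hD : (D () () * (r * a + s * b)).re < 0) :
    IsConeStable r s (Matrix.fromBlocks A 0 C D) := by
  obtain ⟨X₁, X₂, h₁, h₂, hN⟩ := hA
  set Z := r • X₁ + s • X₂ with hZ
  set N := -(A * Z + Zᴴ * Aᴴ) with hNdef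
  set B : Matrix ι Unit ℂ := -(Zᴴ * Cᴴ) with hB
  have hS : (Bᴴ * N⁻¹ * B).PosSemidef := hN.inv.posSemidef.conjTranspose_mul_mul_same B
  set c := (Bᴴ * N⁻¹ * B) () () with hc
  have hc0 : 0 ≤ c := hS.diag_nonneg
  obtain ⟨hcre, hcim⟩ := Complex.nonneg_iff.1 hc0
  set w := (D () () * (r * a + s * b)).re with hw
  set t : ℝ := (c.re + 1) / (-2 * w) with ht
  have htpos : 0 < t := div_pos (by linarith) (by linarith)
  have htw : -2 * w * t = c.re + 1 := by rw [ht]; field_simp [hD.ne]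
  have hdiag {X : Matrix ι ι ℂ} (hX : X.PosDef) {d : ℝ} (hd : 0 < d) :
      (Matrix.fromBlocks X 0 0 (of fun (_ _ : Unit) => ((t * d : ℝ) : ℂ))).PosDef := by
    have := hX.fromBlocks_of_schur (B := (0 : Matrix ι Unit ℂ))
      (D := of fun (_ _ : Unit) => ((t * d : ℝ) : ℂ))
      (posDef_unit (by simpa using mod_cast mul_pos htpos hd))
    simpa using this
  refine ⟨_, _, hdiag h₁ ha, hdiag h₂ hb, ?_⟩
  convert! hN.fromBlocks_of_schur (B := B)
    (D := of fun _ _ => ((c.re + 1 : ℝ) : ℂ)) (posDef_unit ?_) using 1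
  · rw [fromBlocks_smul, fromBlocks_smul, fromBlocks_add, fromBlocks_conjTranspose,
      fromBlocks_conjTranspose, fromBlocks_multiply, fromBlocks_multiply, fromBlocks_add,
      fromBlocks_neg]
    congr 1
    · simp [hNdef, hZ]
    · simp [hB, hZ]
    · simp [hB, hZ]
    · ext ⟨⟩ ⟨⟩
      rw [← htw, hw]
      apply Complex.ext
      · simp [Matrix.mul_apply]
        ring
      · simp [Matrix.mul_apply]
        ring
  · have : c = c.re := Complex.ext rfl (by simpa using hcim.symm)
    rw [Matrix.sub_apply, ← hc, this]
    simp

theorem exists_mulVec_eq_smul_of_mem_spectrum {ι : Type*} [Fintype ι] [DecidableEq ι]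
    {A : Matrix ι ι ℂ} {μ : ℂ} (h : μ ∈ spectrum ℂ A) : ∃ v ≠ 0, A *ᵥ v = μ • v := by
  rw [spectrum.mem_iff, isUnit_iff_isUnit_det, isUnit_iff_ne_zero, not_not,
    ← exists_mulVec_eq_zero_iff] at h
  obtain ⟨v, hv, h⟩ := h
  refine ⟨v, hv, ?_⟩
  rw [sub_mulVec, sub_eq_zero, Algebra.algebraMap_eq_smul_one, smul_mulVec, one_mulVec] at h
  exact h.symm

theorem exists_vecMul_eq_smul_of_mem_spectrum {ι : Type*} [Fintype ι] [DecidableEq ι]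
    {A : Matrix ι ι ℂ} {μ : ℂ} (h : μ ∈ spectrum ℂ A) : ∃ v ≠ 0, v ᵥ* A = μ • v := by
  rw [spectrum.mem_iff, isUnit_iff_isUnit_det, isUnit_iff_ne_zero, not_not,
    ← exists_vecMul_eq_zero_iff] at h
  obtain ⟨v, hv, h⟩ := h
  refine ⟨v, hv, ?_⟩
  rw [vecMul_sub, sub_eq_zero, Algebra.algebraMap_eq_smul_one, vecMul_smul, vecMul_one] at h
  exact h.symm

theorem isConeStable_of_spectrum {r s : ℂ} {n : ℕ} (A : Matrix (Fin n) (Fin n) ℂ)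
    (h : ∀ μ ∈ spectrum ℂ A, ∃ a b : ℝ, 0 < a ∧ 0 < b ∧ (μ * (r * a + s * b)).re < 0) :
    IsConeStable r s A := by
  induction n with
  | zero =>
    refine ⟨1, 1, .one, .one, ?_⟩
    convert! PosDef.one (n := Fin 0) (R := ℂ) using 1
    exact Subsingleton.elim _ _
  | succ n ih =>
    obtain ⟨μ, hμ⟩ := spectrum.nonempty_of_isAlgClosed_of_finiteDimensional ℂ A
    obtain ⟨v, hv, hAv⟩ := exists_mulVec_eq_smul_of_mem_spectrum hμ
    obtain ⟨i, hi⟩ := Function.ne_iff.1 hv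
    set S : Matrix (Fin (n + 1)) (Fin (n + 1)) ℂ := (1 : Matrix _ _ ℂ).updateCol i v with hS
    have hdet : IsUnit S.det := by
      rw [hS, ← cramer_apply, cramer_one]
      simpa using hi
    have hSi : S *ᵥ Pi.single i 1 = v := by ext j; simp [hS]
    have hBi : (S⁻¹ * A * S) *ᵥ Pi.single i 1 = μ • Pi.single i 1 := by
      rw [← mulVec_mulVec, hSi, ← mulVec_mulVec, hAv, mulVec_smul, ← hSi, mulVec_mulVec,
        nonsing_inv_mul _ hdet, one_mulVec]
    let e : Fin (n + 1) ≃ Fin n ⊕ Unit := (finSuccEquiv' i).trans (Equiv.optionEquivSumPUnit _)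
    have hei : e.symm (Sum.inr ()) = i := by simp [e]
    set M := (S⁻¹ * A * S).submatrix e.symm e.symm with hM
    have hcol (j) : M j (Sum.inr ()) = μ * (Pi.single i 1 : Fin (n + 1) → ℂ) (e.symm j) := by
      have := congrFun hBi (e.symm j)
      rw [mulVec_single_one] at this
      simpa [hM, hei] using this
    have h12 : M.toBlocks₁₂ = 0 := by
      ext j ⟨⟩
      have : e.symm (Sum.inl j) ≠ i := by
        rw [← hei]; simp
      simp [toBlocks₁₂, hcol, this]
    have h22 : M.toBlocks₂₂ () () = μ := by simp [toBlocks₂₂, hcol, hei]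
    have hblocks : M = fromBlocks M.toBlocks₁₁ 0 M.toBlocks₂₁ M.toBlocks₂₂ := by
      rw [← h12, fromBlocks_toBlocks]
    have hchar : M.charpoly = A.charpoly := by
      rw [hM, ← reindex_apply, charpoly_reindex, Matrix.mul_assoc, charpoly_mul_comm,
        Matrix.mul_assoc, mul_nonsing_inv _ hdet, Matrix.mul_one]
    have hsub : IsConeStable r s M.toBlocks₁₁ := by
      refine ih _ fun ν hν => h ν ?_
      rw [mem_spectrum_iff_isRoot_charpoly] at hν ⊢
      rw [← hchar, hblocks, charpoly_fromBlocks_zero₁₂]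
      exact Polynomial.root_mul_right_of_isRoot _ hν
    obtain ⟨a, b, ha, hb, hab⟩ := h μ hμ
    have hMst : IsConeStable r s M := by
      rw [hblocks]
      exact hsub.fromBlocks _ _ ha hb (by rwa [h22])
    refine hMst.of_intertwining (S.submatrix id e.symm) ?_ ?_
    · intro x y hxy
      have hinj := vecMul_injective_of_isUnit ((isUnit_iff_isUnit_det S).2 hdet)
      refine hinj (funext fun j => ?_)
      simpa [vecMul, dotProduct] using congrFun hxy (e j)
    · rw [hM, submatrix_mul_equiv, Matrix.mul_assoc, mul_nonsing_inv_cancel_left _ _ hdet]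
      ext j k
      simp [Matrix.mul_apply]

theorem posDef_map_ofReal_iff {ι : Type*} [Fintype ι] {M : Matrix ι ι ℝ} :
    (M.map Complex.ofReal).PosDef ↔ M.PosDef := by
  have hmv (v : ι → ℝ) : M.map Complex.ofReal *ᵥ (fun i => (v i : ℂ)) =
      fun i => ((M *ᵥ v) i : ℂ) := by
    ext i
    simp [mulVec, dotProduct]
  have hdp (v w : ι → ℝ) : (fun i => (v i : ℂ)) ⬝ᵥ (fun i => (w i : ℂ)) = ((v ⬝ᵥ w : ℝ) : ℂ) := by
    simp [dotProduct]
  constructor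
  · intro h
    refine .of_dotProduct_mulVec_pos ?_ fun x hx => ?_
    · ext i j
      simpa using h.isHermitian.apply i j
    · have hx' : (fun i => (x i : ℂ)) ≠ 0 := fun h0 => hx <| by
        ext i
        simpa using congrFun h0 i
      have hpos := h.dotProduct_mulVec_pos hx'
      have hst : star (fun i => (x i : ℂ)) = fun i => (x i : ℂ) := by
        ext i
        simp
      rw [hmv, hst, hdp] at hpos
      simpa using hpos
  · intro h
    refine .of_dotProduct_mulVec_pos ?_ fun x hx => ?_
    · ext i j
      simpa using h.isHermitian.apply i j
    · set a : ι → ℝ := fun i => (x i).re with ha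
      set b : ι → ℝ := fun i => (x i).im with hb
      have hxab : x = (fun i => (a i : ℂ)) + Complex.I • fun i => (b i : ℂ) := by
        ext i
        simp [ha, hb, mul_comm Complex.I, Complex.re_add_im]
      have hsx : star x = (fun i => (a i : ℂ)) - Complex.I • fun i => (b i : ℂ) := by
        ext i
        apply Complex.ext <;> simp [ha, hb]
      have hsymm : a ⬝ᵥ M *ᵥ b = b ⬝ᵥ M *ᵥ a := by
        have hT : Mᵀ = M := h.isHermitian
        rw [dotProduct_mulVec, ← mulVec_transpose, hT, dotProduct_comm]
      have hval : star x ⬝ᵥ (M.map Complex.ofReal *ᵥ x) =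
          ((a ⬝ᵥ M *ᵥ a + b ⬝ᵥ M *ᵥ b : ℝ) : ℂ) := by
        rw [hsx, show M.map Complex.ofReal *ᵥ x = _ from congrArg _ hxab]
        simp only [mulVec_add, mulVec_smul, hmv, sub_dotProduct, dotProduct_add, smul_dotProduct,
          dotProduct_smul, hdp, hsymm, smul_eq_mul, Complex.ofReal_add]
        linear_combination (-(b ⬝ᵥ M *ᵥ b : ℝ) : ℂ) * Complex.I_mul_I
      have hnn (v : ι → ℝ) : 0 ≤ v ⬝ᵥ M *ᵥ v := by
        simpa using h.posSemidef.dotProduct_mulVec_nonneg v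
      have hps {v : ι → ℝ} (hv : v ≠ 0) : 0 < v ⬝ᵥ M *ᵥ v := by
        simpa using h.dotProduct_mulVec_pos hv
      rw [hval, Complex.zero_lt_real]
      by_cases ha0 : a = 0
      · have hb0 : b ≠ 0 := fun hb0 => hx <| by
          rw [hxab, ha0, hb0]
          ext i
          simp
        exact add_pos_of_nonneg_of_pos (hnn a) (hps hb0)
      · exact add_pos_of_pos_of_nonneg (hps ha0) (hnn b)

theorem mul_exp_re (z : ℂ) (θ : ℝ) :
    (z * Complex.exp (θ * Complex.I)).re = ‖z‖ * Real.cos (z.arg + θ) := by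
  conv_lhs => rw [← Complex.norm_mul_exp_arg_mul_I z]
  rw [mul_assoc, ← Complex.exp_add, ← add_mul, Complex.re_ofReal_mul, ← Complex.ofReal_add,
    Complex.exp_ofReal_mul_I_re]

theorem conj_exp_mul_I (θ : ℝ) : starRingEnd ℂ (Complex.exp (θ * Complex.I)) =
    Complex.exp ((-θ : ℝ) * Complex.I) := by
  rw [← Complex.exp_conj]
  simp

/-- The sector `|arg z| > π/2 - θ` is covered by two rotated open left half-planes. -/
theorem sub_lt_abs_arg_iff {z : ℂ} {θ : ℝ} (h0 : 0 < θ) (h1 : θ < Real.pi / 2) :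
    Real.pi / 2 - θ < |z.arg| ↔ (z * Complex.exp (θ * Complex.I)).re < 0 ∨
      (z * starRingEnd ℂ (Complex.exp (θ * Complex.I))).re < 0 := by
  rw [conj_exp_mul_I, mul_exp_re, mul_exp_re]
  constructor
  · intro h
    have hz : 0 < ‖z‖ := norm_pos_iff.2 fun hz => by
      rw [hz, Complex.arg_zero, abs_zero] at h
      linarith
    rcases lt_abs.1 h with h | h
    · left
      refine mul_neg_of_pos_of_neg hz (Real.cos_neg_of_pi_div_two_lt_of_lt (by linarith) ?_)
      linarith [Complex.arg_le_pi z]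
    · right
      refine mul_neg_of_pos_of_neg hz ?_
      rw [← Real.cos_neg]
      refine Real.cos_neg_of_pi_div_two_lt_of_lt (by linarith) ?_
      linarith [Complex.neg_pi_lt_arg z]
  · contrapose!
    intro h
    obtain ⟨h2, h3⟩ := abs_le.1 h
    constructor <;> refine mul_nonneg (norm_nonneg z) (Real.cos_nonneg_of_mem_Icc ⟨?_, ?_⟩) <;>
      linarith

theorem exists_pos_combination_neg {x y : ℝ} (h : x < 0 ∨ y < 0) :
    ∃ a b : ℝ, 0 < a ∧ 0 < b ∧ a * x + b * y < 0 := by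
  rcases h with h | h
  · refine ⟨|y| + 1, -x, by positivity, by linarith, ?_⟩
    nlinarith [le_abs_self y]
  · refine ⟨-y, |x| + 1, by linarith, by positivity, ?_⟩
    nlinarith [le_abs_self x]

theorem Matrix.PosDef.map_conj {ι : Type*} {X : Matrix ι ι ℂ} (hX : X.PosDef) :
    (X.map (starRingEnd ℂ)).PosDef := by
  have : X.map (starRingEnd ℂ) = Xᵀ := by
    ext i j
    exact hX.isHermitian.apply j i
  rw [this]
  exact hX.transpose

/-- If a Hermitian form `-(A Y + Yᴴ Aᴴ)` with `Y = r X₁ + s X₂` is positive definite, then every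
eigenvalue of `A` lies in one of the half-planes `re (μ r) < 0`, `re (μ s) < 0`. -/
theorem re_mul_neg_of_posDef {ι : Type*} [Fintype ι] [DecidableEq ι] {r s μ : ℂ}
    {A X₁ X₂ : Matrix ι ι ℂ} (h₁ : X₁.PosDef) (h₂ : X₂.PosDef)
    (hN : (-(A * (r • X₁ + s • X₂) + (r • X₁ + s • X₂)ᴴ * Aᴴ)).PosDef)
    (hμ : μ ∈ spectrum ℂ A) : (μ * r).re < 0 ∨ (μ * s).re < 0 := by
  obtain ⟨w, hw, hwA⟩ := exists_vecMul_eq_smul_of_mem_spectrum hμ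
  have hw' : star w ≠ 0 := star_ne_zero.2 hw
  have hpos := hN.dotProduct_mulVec_pos hw'
  obtain ⟨ha, ha'⟩ := Complex.pos_iff.1 (h₁.dotProduct_mulVec_pos hw')
  obtain ⟨hb, hb'⟩ := Complex.pos_iff.1 (h₂.dotProduct_mulVec_pos hw')
  rw [star_star] at hpos ha ha' hb hb'
  set a := w ⬝ᵥ X₁ *ᵥ star w with haw
  set b := w ⬝ᵥ X₂ *ᵥ star w with hbw
  have hform : w ⬝ᵥ (A * (r • X₁ + s • X₂)) *ᵥ star w = μ * (r * a + s * b) := by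
    rw [← mulVec_mulVec, dotProduct_mulVec, hwA]
    simp [add_mulVec, smul_mulVec, haw, hbw]
    ring
  have hform' : w ⬝ᵥ ((r • X₁ + s • X₂)ᴴ * Aᴴ) *ᵥ star w = star (μ * (r * a + s * b)) := by
    rw [← hform, ← conjTranspose_mul, ← star_dotProduct_star, star_mulVec, star_star,
      dotProduct_mulVec]
  rw [neg_mulVec, dotProduct_neg, add_mulVec, dotProduct_add, hform, hform'] at hpos
  have hre := (Complex.pos_iff.1 hpos).1
  by_contra! hcon
  obtain ⟨h3, h4⟩ := hcon
  have : (μ * (r * a + s * b)).re = (μ * r).re * a.re + (μ * s).re * b.re := by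
    simp [← ha', ← hb']
    ring
  simp only [Complex.neg_re, Complex.add_re, Complex.star_def, Complex.conj_re, this] at hre
  nlinarith [mul_nonneg h3 ha.le, mul_nonneg h4 hb.le]

theorem exists_posDef_of_isConeStable {ι : Type*} [Fintype ι] {r : ℂ} {A : Matrix ι ι ℝ}
    (h : IsConeStable r (starRingEnd ℂ r) (A.map Complex.ofReal)) :
    ∃ X : Matrix ι ι ℂ, X.PosDef ∧ ∃ Y : Matrix ι ι ℝ,
      Y.map Complex.ofReal = r • X + (starRingEnd ℂ r) • X.map (starRingEnd ℂ) ∧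
        (-(Yᵀ * Aᵀ + A * Y)).PosDef := by
  obtain ⟨X₁, X₂, h₁, h₂, hN⟩ := h
  set Z := r • X₁ + (starRingEnd ℂ r) • X₂ with hZ
  set Y : Matrix ι ι ℝ := of fun i j => 2 * (Z i j).re with hYdef
  have hY : Y.map Complex.ofReal = Z + Z.map (starRingEnd ℂ) := by
    ext i j
    simp [hYdef, Complex.add_conj]
  refine ⟨X₁ + X₂.map (starRingEnd ℂ), h₁.add h₂.map_conj, Y, ?_, ?_⟩
  · rw [hY, hZ]
    ext i j
    simp
    ring
  · rw [← posDef_map_ofReal_iff]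
    convert! hN.add hN.map_conj using 1
    have hsum : (-(Yᵀ * Aᵀ + A * Y)).map Complex.ofReal =
        -((Y.map Complex.ofReal)ᵀ * (A.map Complex.ofReal)ᵀ +
          A.map Complex.ofReal * Y.map Complex.ofReal) := by
      ext i j
      simp [Matrix.mul_apply]
    rw [hsum, hY]
    ext i j
    simp [Matrix.mul_apply, add_mul, mul_add]
    ring

/-- **Lemma 3.** For a real matrix `A` and `0 < q < 1`, with
`θ = (1 − q)π/2` and `r = e^{iθ}`, every complex eigenvalue `λ` of `A`
satisfies `|arg λ| > qπ/2` iff there is a complex Hermitian positive definite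
matrix `X` such that the real symmetric matrix
`(rX + r̄X̄)ᵀAᵀ + A(rX + r̄X̄)` is negative definite. -/
theorem fractional_stability_LMI
    (n : ℕ) (hn : 0 < n) (A : Matrix (Fin n) (Fin n) ℝ)
    (q : ℝ) (hq0 : 0 < q) (hq1 : q < 1)
    (θ : ℝ) (hθ : θ = (1 - q) * Real.pi / 2)
    (r : ℂ) (hr : r = Complex.exp (θ * Complex.I)) :
    (∀ lam ∈ spectrum ℂ (A.map (Complex.ofReal)),
        q * Real.pi / 2 < |Complex.arg lam|) ↔
      ∃ X : Matrix (Fin n) (Fin n) ℂ, X.PosDef ∧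
        ∃ Y : Matrix (Fin n) (Fin n) ℝ,
          Y.map (Complex.ofReal)
              = r • X + (starRingEnd ℂ r) • X.map (starRingEnd ℂ) ∧
            (-(Yᵀ * Aᵀ + A * Y)).PosDef := by
  have h0 : 0 < θ := by rw [hθ]; nlinarith [Real.pi_pos]
  have h1 : θ < Real.pi / 2 := by rw [hθ]; nlinarith [Real.pi_pos]
  have hq : q * Real.pi / 2 = Real.pi / 2 - θ := by rw [hθ]; ring
  simp_rw [hq, sub_lt_abs_arg_iff h0 h1, ← hr]
  constructor
  · intro h
    refine exists_posDef_of_isConeStable (isConeStable_of_spectrum _ fun μ hμ => ?_)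
    obtain ⟨a, b, ha, hb, hab⟩ := exists_pos_combination_neg (h μ hμ)
    refine ⟨a, b, ha, hb, ?_⟩
    rw [mul_add, ← mul_assoc, ← mul_assoc, Complex.add_re, Complex.re_mul_ofReal,
      Complex.re_mul_ofReal]
    linarith
  · rintro ⟨X, hX, Y, hY, hN⟩ μ hμ
    refine re_mul_neg_of_posDef hX hX.map_conj ?_ hμ
    rw [← hY]
    convert! posDef_map_ofReal_iff.2 hN using 1
    ext i j
    simp [Matrix.mul_apply, add_comm]
end
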